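/- There exist R ≥ 1 and a finite constant C (depending only on d, α, δ and φ) such that for every ξ ∈ ℝ^d with |ξ| ≥ R one has |F(ξ) − Ḟ(ξ)| + sup_{n ≥ 1} |F^n(ξ) − Ḟ^n(ξ)| ≤ C ⟨ξ⟩^{−2δ(d+2α)/(d+2)}. -/

import Mathlib

open MeasureTheory Real

noncomputable section

/-- Orthogonal projection of `w` onto the orthogonal complement of `span {v}`
(for `v = 0` this formula returns `w` itself, an irrelevant convention). -/
def Pperp (d : ℕ) (v w : EuclideanSpace ℝ (Fin d)) : EuclideanSpace ℝ (Fin d) :=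
  w - (((inner ℝ v w : ℝ)) / ‖v‖ ^ 2) • v

/-- Japanese bracket `⟨ξ⟩ = (1 + |ξ|²)^{1/2}`. -/
def jb (d : ℕ) (ξ : EuclideanSpace ℝ (Fin d)) : ℝ := Real.sqrt (1 + ‖ξ‖ ^ 2)

/-- The kernel `K(ξ,η) = |P⊥_{ξ-η} ξ|² ⟨ξ-η⟩^{-(d+2α)}`. -/
def Kker (d : ℕ) (α : ℝ) (ξ η : EuclideanSpace ℝ (Fin d)) : ℝ :=
  ‖Pperp d (ξ - η) ξ‖ ^ 2 * jb d (ξ - η) ^ (-((d : ℝ) + 2 * α))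

/-- `φ_n(r) := φ(r/n)`. -/
def phin (φ : ℝ → ℝ) (n : ℕ) (r : ℝ) : ℝ := φ (r / n)

/-- `F^n(ξ)`. -/
def Fn (d : ℕ) (α δ : ℝ) (φ : ℝ → ℝ) (n : ℕ) (ξ : EuclideanSpace ℝ (Fin d)) : ℝ :=
  (2 * π) ^ (-(d : ℝ) / 2) *
    ∫ η : EuclideanSpace ℝ (Fin d),
      Kker d α ξ η *
        (phin φ n ‖η‖ * jb d η ^ (-(2 * δ)) - phin φ n ‖ξ‖ * jb d ξ ^ (-(2 * δ)))

/-- `Ḟ^n(ξ)`. -/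
def Fdotn (d : ℕ) (α δ : ℝ) (φ : ℝ → ℝ) (n : ℕ) (ξ : EuclideanSpace ℝ (Fin d)) : ℝ :=
  (2 * π) ^ (-(d : ℝ) / 2) *
    ∫ η : EuclideanSpace ℝ (Fin d),
      Kker d α ξ η *
        (phin φ n ‖η‖ * ‖η‖ ^ (-(2 * δ)) - phin φ n ‖ξ‖ * ‖ξ‖ ^ (-(2 * δ)))

/-- `F(ξ)` : as `F^n(ξ)` with `φ_n` replaced by the constant `1`. -/
def Finf (d : ℕ) (α δ : ℝ) (ξ : EuclideanSpace ℝ (Fin d)) : ℝ :=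
  (2 * π) ^ (-(d : ℝ) / 2) *
    ∫ η : EuclideanSpace ℝ (Fin d),
      Kker d α ξ η * (jb d η ^ (-(2 * δ)) - jb d ξ ^ (-(2 * δ)))

/-- `Ḟ(ξ)` : as `Ḟ^n(ξ)` with `φ_n` replaced by the constant `1`. -/
def Fdotinf (d : ℕ) (α δ : ℝ) (ξ : EuclideanSpace ℝ (Fin d)) : ℝ :=
  (2 * π) ^ (-(d : ℝ) / 2) *
    ∫ η : EuclideanSpace ℝ (Fin d),
      Kker d α ξ η * (‖η‖ ^ (-(2 * δ)) - ‖ξ‖ ^ (-(2 * δ)))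

lemma aux_Pperp_swap (d : ℕ) (x y : EuclideanSpace ℝ (Fin d)) :
    Pperp d (x - y) x = Pperp d (x - y) y := by
  by_cases h : x - y = 0
  · have : x = y := sub_eq_zero.mp h
    rw [this]
  · have hn : ‖x - y‖ ^ 2 ≠ 0 := by positivity
    have h1 : (inner ℝ (x - y) x : ℝ) = inner ℝ (x - y) y + ‖x - y‖ ^ 2 := by
      rw [← real_inner_self_eq_norm_sq, ← inner_add_right]; congr 1; abel
    unfold Pperp
    rw [h1, add_div, div_self hn, add_smul, one_smul]
    abel

lemma aux_Pperp_le (d : ℕ) (v w : EuclideanSpace ℝ (Fin d)) :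
    ‖Pperp d v w‖ ^ 2 ≤ ‖w‖ ^ 2 := by
  by_cases h : v = 0
  · simp [Pperp, h]
  · have hn : ‖v‖ ^ 2 ≠ 0 := by positivity
    unfold Pperp
    rw [norm_sub_sq_real, inner_smul_right, norm_smul, mul_pow, real_inner_comm v w,
      Real.norm_eq_abs, sq_abs]
    have : (inner ℝ v w / ‖v‖ ^ 2) ^ 2 * ‖v‖ ^ 2
        = (inner ℝ v w / ‖v‖ ^ 2) * (inner ℝ v w : ℝ) := by
      field_simp
    rw [this]
    have h2 : 0 ≤ (inner ℝ v w / ‖v‖ ^ 2) * (inner ℝ v w : ℝ) := by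
      rw [div_mul_eq_mul_div]
      exact div_nonneg (mul_self_nonneg _) (by positivity)
    rw [real_inner_comm w v] at *
    linarith

/-- the weight -/
def auxJ (d : ℕ) (α : ℝ) (z : EuclideanSpace ℝ (Fin d)) : ℝ := jb d z ^ (-((d : ℝ) + 2 * α))

lemma aux_jb_pos (d : ℕ) (z : EuclideanSpace ℝ (Fin d)) : 0 < jb d z := by
  unfold jb; positivity

lemma aux_one_le_jb (d : ℕ) (z : EuclideanSpace ℝ (Fin d)) : 1 ≤ jb d z := by
  unfold jb; rw [Real.one_le_sqrt]; nlinarith [sq_nonneg ‖z‖]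

lemma aux_norm_le_jb (d : ℕ) (z : EuclideanSpace ℝ (Fin d)) : ‖z‖ ≤ jb d z := by
  unfold jb; apply Real.le_sqrt_of_sq_le; linarith

lemma aux_jb_rpow (d : ℕ) (z : EuclideanSpace ℝ (Fin d)) (s : ℝ) :
    jb d z ^ (-s) = (1 + ‖z‖ ^ 2) ^ (-s / 2) := by
  unfold jb
  rw [Real.sqrt_eq_rpow, ← Real.rpow_mul (by positivity)]
  congr 1; ring

lemma auxJ_nonneg (d : ℕ) (α : ℝ) (z : EuclideanSpace ℝ (Fin d)) : 0 ≤ auxJ d α z :=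
  (Real.rpow_pos_of_pos (aux_jb_pos d z) _).le

lemma auxJ_integrable (d : ℕ) (α : ℝ) (hα : 0 < α) : Integrable (auxJ d α) := by
  have := integrable_rpow_neg_one_add_norm_sq (E := EuclideanSpace ℝ (Fin d)) (μ := volume)
    (r := (d : ℝ) + 2 * α) (by simp; linarith)
  refine this.congr (Filter.Eventually.of_forall fun z => ?_)
  simp only [auxJ, aux_jb_rpow]

lemma aux_K_nonneg (d : ℕ) (α : ℝ) (x y : EuclideanSpace ℝ (Fin d)) : 0 ≤ Kker d α x y :=
  mul_nonneg (by positivity) (auxJ_nonneg d α _)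

lemma aux_K_le1 (d : ℕ) (α : ℝ) (x y : EuclideanSpace ℝ (Fin d)) :
    Kker d α x y ≤ ‖x‖ ^ 2 * auxJ d α (x - y) :=
  mul_le_mul_of_nonneg_right (aux_Pperp_le d _ _) (auxJ_nonneg d α _)

lemma aux_K_le2 (d : ℕ) (α : ℝ) (x y : EuclideanSpace ℝ (Fin d)) :
    Kker d α x y ≤ ‖y‖ ^ 2 * auxJ d α (x - y) := by
  unfold Kker
  rw [aux_Pperp_swap]
  exact mul_le_mul_of_nonneg_right (aux_Pperp_le d _ _) (auxJ_nonneg d α _)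

lemma aux_jb_meas (d : ℕ) : Measurable (jb d) := by
  unfold jb; fun_prop

lemma aux_K_meas (d : ℕ) (α : ℝ) (x : EuclideanSpace ℝ (Fin d)) :
    Measurable (Kker d α x) := by
  have := aux_jb_meas d
  unfold Kker Pperp
  fun_prop

lemma aux_K_int (d : ℕ) (α : ℝ) (hα : 0 < α) (x : EuclideanSpace ℝ (Fin d)) :
    Integrable (Kker d α x) := by
  refine Integrable.mono' (((auxJ_integrable d α hα).comp_sub_left x).const_mul (‖x‖ ^ 2))
    (aux_K_meas d α x).aestronglyMeasurable (Filter.Eventually.of_forall fun y => ?_)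
  rw [Real.norm_of_nonneg (aux_K_nonneg d α x y)]
  exact aux_K_le1 d α x y

/-- the difference of the two powers -/
def auxh (d : ℕ) (δ : ℝ) (y : EuclideanSpace ℝ (Fin d)) : ℝ :=
  ‖y‖ ^ (-(2 * δ)) - jb d y ^ (-(2 * δ))

lemma auxh_nonneg (d : ℕ) (δ : ℝ) (hδ : 0 < δ) (y : EuclideanSpace ℝ (Fin d)) (hy : y ≠ 0) :
    0 ≤ auxh d δ y := by
  unfold auxh
  rw [sub_nonneg]
  exact Real.rpow_le_rpow_of_nonpos (norm_pos_iff.mpr hy) (aux_norm_le_jb d y) (by linarith)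

lemma auxh_le (d : ℕ) (δ : ℝ) (hδ : 0 < δ) (hδ1 : δ < 1) (y : EuclideanSpace ℝ (Fin d))
    (hy : y ≠ 0) : auxh d δ y * (1 + ‖y‖ ^ 2) ≤ ‖y‖ ^ (-(2 * δ)) := by
  have hr : 0 < ‖y‖ := norm_pos_iff.mpr hy
  have ht : 0 < ‖y‖ ^ 2 := by positivity
  have e1 : ‖y‖ ^ (-(2 * δ)) = (‖y‖ ^ 2) ^ (-δ) := by
    rw [← Real.rpow_natCast ‖y‖ 2, ← Real.rpow_mul hr.le]; congr 1; push_cast; ring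
  unfold auxh
  rw [aux_jb_rpow, e1, show -(2 * δ) / 2 = -δ by ring]
  generalize ‖y‖ ^ 2 = t at *
  have h1t : 0 < 1 + t := by linarith
  have k1 : t / (1 + t) ≤ (t / (1 + t)) ^ δ := by
    have := Real.rpow_le_rpow_of_exponent_ge (x := t / (1 + t)) (by positivity)
      (by rw [div_le_one h1t]; linarith) hδ1.le
    simpa using this
  have k2 : (1 + t) ^ (-δ) = t ^ (-δ) * (t / (1 + t)) ^ δ := by
    rw [Real.div_rpow ht.le h1t.le, Real.rpow_neg ht.le, Real.rpow_neg h1t.le]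
    have := (Real.rpow_pos_of_pos ht δ).ne'
    field_simp
  rw [k2]
  have hp := Real.rpow_pos_of_pos ht (-δ)
  have k3 : t ≤ (t / (1 + t)) ^ δ * (1 + t) := by
    rwa [div_le_iff₀ h1t] at k1
  nlinarith

lemma auxh_meas (d : ℕ) (δ : ℝ) : Measurable (auxh d δ) := by
  have := aux_jb_meas d
  unfold auxh
  fun_prop

/-- pointwise bound for `K h` -/
lemma aux_Kh_le (d : ℕ) (α δ ρ : ℝ) (hα : 0 < α) (hδ : 0 < δ) (hδ1 : δ < 1)
    (x y : EuclideanSpace ℝ (Fin d)) (hρ : 0 < ρ) (hρx : ρ ≤ ‖x‖ / 2) :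
    |Kker d α x y * auxh d δ y| ≤ ρ ^ (-(2 * δ)) * auxJ d α (x - y) +
      (Metric.ball (0 : EuclideanSpace ℝ (Fin d)) ρ).indicator
        (fun _ => ρ ^ (2 - 2 * δ) * (‖x‖ / 2) ^ (-((d : ℝ) + 2 * α))) y := by
  have hJ := auxJ_nonneg d α (x - y)
  have hK := aux_K_nonneg d α x y
  have hx : 0 < ‖x‖ / 2 := by linarith
  have hind : 0 ≤ (Metric.ball (0 : EuclideanSpace ℝ (Fin d)) ρ).indicator
        (fun _ => ρ ^ (2 - 2 * δ) * (‖x‖ / 2) ^ (-((d : ℝ) + 2 * α))) y :=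
    Set.indicator_nonneg (fun _ _ => by positivity) _
  have hρp : 0 < ρ ^ (-(2 * δ)) := by positivity
  by_cases hy : y = 0
  · have : Kker d α x y = 0 := by
      have := aux_K_le2 d α x y
      rw [hy, norm_zero] at this
      rw [hy] at hK ⊢
      nlinarith
    rw [this]; simp only [zero_mul, abs_zero]; positivity
  have hr : 0 < ‖y‖ := norm_pos_iff.mpr hy
  have hh := auxh_nonneg d δ hδ y hy
  have hh2 := auxh_le d δ hδ hδ1 y hy
  rw [abs_of_nonneg (mul_nonneg hK hh)]
  have m1 : Kker d α x y * auxh d δ y ≤ auxJ d α (x - y) * (‖y‖ ^ 2 * auxh d δ y) := by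
    calc _ ≤ ‖y‖ ^ 2 * auxJ d α (x - y) * auxh d δ y :=
          mul_le_mul_of_nonneg_right (aux_K_le2 d α x y) hh
      _ = _ := by ring
  by_cases hball : ‖y‖ < ρ
  · rw [Set.indicator_of_mem (by simpa using hball)]
    have a1 : auxJ d α (x - y) ≤ (‖x‖ / 2) ^ (-((d : ℝ) + 2 * α)) := by
      apply Real.rpow_le_rpow_of_nonpos hx
      · have := norm_sub_norm_le x y
        have := aux_norm_le_jb d (x - y)
        linarith
      · have : (0 : ℝ) ≤ d := by positivity
        linarith
    have a2 : ‖y‖ ^ 2 * auxh d δ y ≤ ρ ^ (2 - 2 * δ) := by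
      have b1 : auxh d δ y ≤ ‖y‖ ^ (-(2 * δ)) := by nlinarith [sq_nonneg ‖y‖]
      calc _ ≤ ‖y‖ ^ 2 * ‖y‖ ^ (-(2 * δ)) := by gcongr
        _ = ‖y‖ ^ (2 - 2 * δ) := by
          rw [← Real.rpow_natCast ‖y‖ 2, ← Real.rpow_add hr]; congr 1
        _ ≤ _ := Real.rpow_le_rpow hr.le hball.le (by linarith)
    have a3 : auxJ d α (x - y) * (‖y‖ ^ 2 * auxh d δ y) ≤
        (‖x‖ / 2) ^ (-((d : ℝ) + 2 * α)) * ρ ^ (2 - 2 * δ) := by gcongr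
    have : 0 ≤ ρ ^ (-(2 * δ)) * auxJ d α (x - y) := by positivity
    linarith
  · push Not at hball
    have a2 : ‖y‖ ^ 2 * auxh d δ y ≤ ρ ^ (-(2 * δ)) := by
      have b2 : ‖y‖ ^ (-(2 * δ)) ≤ ρ ^ (-(2 * δ)) :=
        Real.rpow_le_rpow_of_nonpos hρ hball (by linarith)
      linarith
    have a3 : auxJ d α (x - y) * (‖y‖ ^ 2 * auxh d δ y) ≤
        auxJ d α (x - y) * ρ ^ (-(2 * δ)) := by gcongr
    linarith

lemma aux_dom_int (d : ℕ) (α δ ρ : ℝ) (hα : 0 < α) (x : EuclideanSpace ℝ (Fin d)) (c : ℝ) :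
    Integrable (fun y : EuclideanSpace ℝ (Fin d) => ρ ^ (-(2 * δ)) * auxJ d α (x - y) +
      (Metric.ball (0 : EuclideanSpace ℝ (Fin d)) ρ).indicator (fun _ => c) y) := by
  refine (((auxJ_integrable d α hα).comp_sub_left x).const_mul _).add ?_
  rw [integrable_indicator_iff measurableSet_ball]
  exact integrableOn_const measure_ball_lt_top.ne

lemma aux_general (d : ℕ) (hd : 2 ≤ d) (α δ ρ : ℝ) (hα : 0 < α)
    (hδ : 0 < δ) (hδ1 : δ < 1) (c : EuclideanSpace ℝ (Fin d) → ℝ) (hc : Measurable c)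
    (hc0 : ∀ y, 0 ≤ c y) (hc1 : ∀ y, c y ≤ 1)
    (x : EuclideanSpace ℝ (Fin d)) (hρ : 0 < ρ) (hρx : ρ ≤ ‖x‖ / 2)
    (hρ2 : ρ ^ ((d : ℝ) + 2) ≤ (‖x‖ / 2) ^ ((d : ℝ) + 2 * α)) :
    |(∫ y, Kker d α x y * (c y * jb d y ^ (-(2 * δ)) - c x * jb d x ^ (-(2 * δ)))) -
      ∫ y, Kker d α x y * (c y * ‖y‖ ^ (-(2 * δ)) - c x * ‖x‖ ^ (-(2 * δ)))| ≤
    (2 * (∫ z, auxJ d α z) + volume.real (Metric.ball (0 : EuclideanSpace ℝ (Fin d)) 1)) *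
      ρ ^ (-(2 * δ)) := by
  have hx : 0 < ‖x‖ / 2 := by linarith
  have hx0 : x ≠ 0 := norm_pos_iff.mp (by linarith)
  have hKi := aux_K_int d α hα x
  have hKm := aux_K_meas d α x
  have hjm := aux_jb_meas d
  have hhm := auxh_meas d δ
  set D := ρ ^ (2 - 2 * δ) * (‖x‖ / 2) ^ (-((d : ℝ) + 2 * α)) with hD
  have hdom := aux_dom_int d α δ ρ hα x D
  have hKh : Integrable (fun y => Kker d α x y * (c y * auxh d δ y)) := by
    refine hdom.mono' (by fun_prop) (Filter.Eventually.of_forall fun y => ?_)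
    refine le_trans ?_ (aux_Kh_le d α δ ρ hα hδ hδ1 x y hρ hρx)
    rw [Real.norm_eq_abs, abs_mul, abs_mul, abs_mul, abs_of_nonneg (hc0 y)]
    gcongr
    exact mul_le_of_le_one_left (abs_nonneg _) (hc1 y)
  have hKj : Integrable (fun y => Kker d α x y * (c y * jb d y ^ (-(2 * δ)))) := by
    refine hKi.mono' (by fun_prop) (Filter.Eventually.of_forall fun y => ?_)
    have h1 : jb d y ^ (-(2 * δ)) ≤ 1 :=
      Real.rpow_le_one_of_one_le_of_nonpos (aux_one_le_jb d y) (by linarith)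
    have h0 : 0 ≤ jb d y ^ (-(2 * δ)) := Real.rpow_nonneg (aux_jb_pos d y).le _
    rw [Real.norm_of_nonneg (mul_nonneg (aux_K_nonneg d α x y) (mul_nonneg (hc0 y) h0))]
    exact mul_le_of_le_one_right (aux_K_nonneg d α x y) (mul_le_one₀ (hc1 y) h0 h1)
  have i1 : Integrable (fun y => Kker d α x y *
      (c y * jb d y ^ (-(2 * δ)) - c x * jb d x ^ (-(2 * δ)))) := by
    simp only [mul_sub]
    exact hKj.sub (hKi.mul_const _)
  have i2 : Integrable (fun y => Kker d α x y *
      (c y * ‖y‖ ^ (-(2 * δ)) - c x * ‖x‖ ^ (-(2 * δ)))) := by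
    have := (hKj.add hKh).sub (hKi.mul_const (c x * ‖x‖ ^ (-(2 * δ))))
    refine this.congr (Filter.Eventually.of_forall fun y => ?_)
    simp only [Pi.sub_apply, Pi.add_apply, auxh]
    ring
  rw [← integral_sub i1 i2]
  have hI : Integrable (fun y => ρ ^ (-(2 * δ)) * auxJ d α (x - y)) :=
    ((auxJ_integrable d α hα).comp_sub_left x).const_mul _
  have hbound : ∀ y, ‖Kker d α x y * (c y * jb d y ^ (-(2 * δ)) - c x * jb d x ^ (-(2 * δ))) -
      Kker d α x y * (c y * ‖y‖ ^ (-(2 * δ)) - c x * ‖x‖ ^ (-(2 * δ)))‖ ≤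
      ρ ^ (-(2 * δ)) * auxJ d α (x - y) + (ρ ^ (-(2 * δ)) * auxJ d α (x - y) +
      (Metric.ball (0 : EuclideanSpace ℝ (Fin d)) ρ).indicator (fun _ => D) y) := by
    intro y
    have e : Kker d α x y * (c y * jb d y ^ (-(2 * δ)) - c x * jb d x ^ (-(2 * δ))) -
      Kker d α x y * (c y * ‖y‖ ^ (-(2 * δ)) - c x * ‖x‖ ^ (-(2 * δ))) =
      c x * (Kker d α x y * auxh d δ x) - c y * (Kker d α x y * auxh d δ y) := by
      unfold auxh; ring
    rw [e, Real.norm_eq_abs]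
    refine (abs_sub _ _).trans (add_le_add ?_ ?_)
    · have hh := auxh_nonneg d δ hδ x hx0
      have hh2 := auxh_le d δ hδ hδ1 x hx0
      have hK := aux_K_nonneg d α x y
      have hJ := auxJ_nonneg d α (x - y)
      rw [abs_of_nonneg (mul_nonneg (hc0 x) (mul_nonneg hK hh))]
      refine (mul_le_of_le_one_left (mul_nonneg hK hh) (hc1 x)).trans ?_
      have b2 : ‖x‖ ^ (-(2 * δ)) ≤ ρ ^ (-(2 * δ)) :=
        Real.rpow_le_rpow_of_nonpos hρ (by linarith) (by linarith)
      calc _ ≤ ‖x‖ ^ 2 * auxJ d α (x - y) * auxh d δ x :=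
            mul_le_mul_of_nonneg_right (aux_K_le1 d α x y) hh
        _ = (‖x‖ ^ 2 * auxh d δ x) * auxJ d α (x - y) := by ring
        _ ≤ _ := mul_le_mul_of_nonneg_right (by linarith) hJ
    · refine le_trans ?_ (aux_Kh_le d α δ ρ hα hδ hδ1 x y hρ hρx)
      rw [abs_mul, abs_of_nonneg (hc0 y)]
      exact mul_le_of_le_one_left (abs_nonneg _) (hc1 y)
  have hmain := norm_integral_le_of_norm_le (hI.add hdom) (Filter.Eventually.of_forall hbound)
  rw [Real.norm_eq_abs] at hmain
  refine hmain.trans ?_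
  simp only [Pi.add_apply]
  have hind : Integrable ((Metric.ball (0 : EuclideanSpace ℝ (Fin d)) ρ).indicator
      (fun _ => D)) := by
    rw [integrable_indicator_iff measurableSet_ball]
    exact integrableOn_const measure_ball_lt_top.ne
  rw [integral_add hI hdom, integral_add hI hind, integral_const_mul,
    integral_sub_left_eq_self (auxJ d α), integral_indicator_const _ measurableSet_ball]
  have hvol : volume.real (Metric.ball (0 : EuclideanSpace ℝ (Fin d)) ρ) =
      ρ ^ d * volume.real (Metric.ball (0 : EuclideanSpace ℝ (Fin d)) 1) := by
    rw [Measure.real, Measure.addHaar_ball_of_pos _ _ hρ, ENNReal.toReal_mul,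
      ENNReal.toReal_ofReal (by positivity)]
    simp [Measure.real]
  have hfin : ρ ^ d * D ≤ ρ ^ (-(2 * δ)) := by
    have : ρ ^ d * D = ρ ^ (-(2 * δ)) *
        (ρ ^ ((d : ℝ) + 2) * (‖x‖ / 2) ^ (-((d : ℝ) + 2 * α))) := by
      rw [hD, ← mul_assoc, ← mul_assoc, ← Real.rpow_natCast ρ d, ← Real.rpow_add hρ,
        ← Real.rpow_add hρ]
      congr 2; ring
    rw [this]
    refine mul_le_of_le_one_right (by positivity) ?_
    rw [Real.rpow_neg hx.le, ← div_eq_mul_inv]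
    exact (div_le_one (by positivity)).mpr hρ2
  rw [hvol, smul_eq_mul]
  have hV : 0 ≤ volume.real (Metric.ball (0 : EuclideanSpace ℝ (Fin d)) 1) := by positivity
  nlinarith

/-- There exist `R ≥ 1` and a finite constant `C` (depending only on `d, α, δ, φ`) such that
for every `ξ` with `|ξ| ≥ R`,
`|F(ξ) − Ḟ(ξ)| + sup_{n ≥ 1} |F^n(ξ) − Ḟ^n(ξ)| ≤ C ⟨ξ⟩^{−2δ(d+2α)/(d+2)}`
(here stated with the supremum over `n ≥ 1` expressed as a uniform bound in `n`). -/
theorem stmt1 (d : ℕ) (hd : 2 ≤ d) (α δ : ℝ)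
    (hα : α ∈ Set.Ioo (0 : ℝ) (1 / 2)) (hδ : δ ∈ Set.Ioo (0 : ℝ) 1)
    (φ : ℝ → ℝ)
    (hφ_smooth : ContDiffOn ℝ (⊤ : ℕ∞) φ (Set.Ici 0))
    (hφ_anti : AntitoneOn φ (Set.Ici 0))
    (hφ_range : ∀ r : ℝ, 0 ≤ r → φ r ∈ Set.Icc (0 : ℝ) 1)
    (hφ_one : ∀ r ∈ Set.Icc (0 : ℝ) 1, φ r = 1)
    (hφ_zero : ∀ r : ℝ, 2 ≤ r → φ r = 0) :
    ∃ R : ℝ, 1 ≤ R ∧ ∃ C : ℝ, 0 ≤ C ∧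
      ∀ ξ : EuclideanSpace ℝ (Fin d), R ≤ ‖ξ‖ → ∀ n : ℕ, 1 ≤ n →
        |Finf d α δ ξ - Fdotinf d α δ ξ| + |Fn d α δ φ n ξ - Fdotn d α δ φ n ξ| ≤
          C * jb d ξ ^ (-(2 * δ * ((d : ℝ) + 2 * α) / ((d : ℝ) + 2))) := by
  have hα0 := hα.1
  have hα1 := hα.2
  have hδ0 := hδ.1
  have hδ1 := hδ.2
  have hdR : (2 : ℝ) ≤ d := by exact_mod_cast hd
  set M := 2 * (∫ z, auxJ d α z) + volume.real (Metric.ball (0 : EuclideanSpace ℝ (Fin d)) 1)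
    with hM
  have hM0 : 0 ≤ M := by
    have : 0 ≤ ∫ z, auxJ d α z := integral_nonneg (auxJ_nonneg d α)
    positivity
  have hP : 0 < (2 * π) ^ (-(d : ℝ) / 2) := by positivity
  set P := (2 * π) ^ (-(d : ℝ) / 2) with hPdef
  refine ⟨1, le_rfl, 2 * P * M * 4 ^ (2 * δ), by positivity, fun x hx n hn => ?_⟩
  set θ := ((d : ℝ) + 2 * α) / ((d : ℝ) + 2) with hθ
  have hθ0 : 0 < θ := by positivity
  have hθ1 : θ ≤ 1 := by rw [hθ, div_le_one (by positivity)]; linarith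
  have hx0 : 0 < ‖x‖ := by linarith
  set ρ := ‖x‖ ^ θ / 2 with hρd
  have hρ : 0 < ρ := by positivity
  have hρx : ρ ≤ ‖x‖ / 2 := by
    have := Real.rpow_le_rpow_of_exponent_le hx hθ1
    rw [Real.rpow_one] at this
    linarith
  have hρ2 : ρ ^ ((d : ℝ) + 2) ≤ (‖x‖ / 2) ^ ((d : ℝ) + 2 * α) := by
    rw [hρd, Real.div_rpow (by positivity) (by norm_num), Real.div_rpow hx0.le (by norm_num),
      ← Real.rpow_mul hx0.le, hθ, div_mul_cancel₀ _ (by positivity)]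
    have : (2 : ℝ) ^ ((d : ℝ) + 2 * α) ≤ 2 ^ ((d : ℝ) + 2) :=
      Real.rpow_le_rpow_of_exponent_le (by norm_num) (by linarith)
    gcongr
  have hfinal : ρ ^ (-(2 * δ)) ≤ 4 ^ (2 * δ) *
      jb d x ^ (-(2 * δ * ((d : ℝ) + 2 * α) / ((d : ℝ) + 2))) := by
    have hj := aux_jb_pos d x
    have h1 : jb d x ≤ 2 * ‖x‖ := by
      unfold jb
      rw [Real.sqrt_le_left (by positivity)]
      nlinarith
    have h2 : jb d x ^ θ ≤ 4 * ρ := by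
      calc jb d x ^ θ ≤ (2 * ‖x‖) ^ θ := Real.rpow_le_rpow hj.le h1 hθ0.le
        _ = 2 ^ θ * ‖x‖ ^ θ := Real.mul_rpow (by norm_num) hx0.le
        _ ≤ 2 * ‖x‖ ^ θ := by
          have := Real.rpow_le_rpow_of_exponent_le (x := 2) (by norm_num) hθ1
          rw [Real.rpow_one] at this
          gcongr
        _ = 4 * ρ := by rw [hρd]; ring
    have h3 : (4 * ρ) ^ (-(2 * δ)) ≤ (jb d x ^ θ) ^ (-(2 * δ)) :=
      Real.rpow_le_rpow_of_nonpos (by positivity) h2 (by linarith)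
    rw [← Real.rpow_mul hj.le, Real.mul_rpow (by norm_num) hρ.le,
      Real.rpow_neg (by norm_num)] at h3
    have h4 : θ * -(2 * δ) = -(2 * δ * ((d : ℝ) + 2 * α) / ((d : ℝ) + 2)) := by
      rw [hθ]; ring
    rw [h4, inv_mul_le_iff₀ (by positivity)] at h3
    exact h3
  have hn0 : (0 : ℝ) < n := by exact_mod_cast hn
  have g1 := aux_general d hd α δ ρ hα0 hδ0 hδ1 (fun _ => 1) measurable_const
    (fun _ => zero_le_one) (fun _ => le_rfl) x hρ hρx hρ2
  have hcm : Measurable (fun y : EuclideanSpace ℝ (Fin d) => phin φ n ‖y‖) := by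
    apply Continuous.measurable
    unfold phin
    exact hφ_smooth.continuousOn.comp_continuous (by fun_prop)
      (fun y => Set.mem_Ici.mpr (by positivity))
  have g2 := aux_general d hd α δ ρ hα0 hδ0 hδ1 (fun y => phin φ n ‖y‖) hcm
    (fun y => (hφ_range _ (by positivity)).1) (fun y => (hφ_range _ (by positivity)).2)
    x hρ hρx hρ2
  simp only [one_mul] at g1
  have f1 : |Finf d α δ x - Fdotinf d α δ x| ≤ P * (M * ρ ^ (-(2 * δ))) := by
    unfold Finf Fdotinf
    rw [← mul_sub, abs_mul, abs_of_pos hP]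
    exact mul_le_mul_of_nonneg_left g1 hP.le
  have f2 : |Fn d α δ φ n x - Fdotn d α δ φ n x| ≤ P * (M * ρ ^ (-(2 * δ))) := by
    unfold Fn Fdotn
    rw [← mul_sub, abs_mul, abs_of_pos hP]
    exact mul_le_mul_of_nonneg_left g2 hP.le
  have f3 : P * (M * ρ ^ (-(2 * δ))) ≤ P * (M * (4 ^ (2 * δ) *
      jb d x ^ (-(2 * δ * ((d : ℝ) + 2 * α) / ((d : ℝ) + 2))))) := by gcongr
  linarith

end
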